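/- In the setting of the point–line–plane aided INS (state dimension 25, block rows M_p, M_l, M_π and null matrix N_{plπ} as in the corresponding statement), assume additionally that gravity is vertical: g = −g₀·e₃ for some g₀ ∈ ℝ. Let h_z ∈ ℝ¹ˣ²⁵ be the row with e₃ᵀ in the position block and zeros in all other blocks (the block row contributed by a global-z position measurement). Let N_z ∈ ℝ²⁵ˣ³ consist of column 1 of N_{plπ} (the rotation-about-gravity direction) together with the products of columns 2–4 of N_{plπ} with e₁ and with e₂ (the x- and y-translation directions). Then h_z·N_z = 0, M_p·N_z = 0, M_l·N_z = 0, and M_π·N_z = 0; in particular e₃ᵀ⌊P₁×⌋g = 0. Hence after adding a global-z measurement, the rotation about gravity and the horizontal translations remain unobservable, while only the z-translation direction is removed from this subspace. -/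

import Mathlib

open Matrix

noncomputable section

abbrev V3 : Type := Fin 3 → ℝ
abbrev M3 : Type := Matrix (Fin 3) (Fin 3) ℝ

/-- The skew-symmetric cross-product matrix `⌊v×⌋`. -/
def skew (v : V3) : M3 :=
  !![0, -(v 2), v 1; v 2, 0, -(v 0); -(v 1), v 0, 0]

/-- `R` is a rotation matrix: `RᵀR = I₃` and `det R = 1`. -/
def IsRot (R : M3) : Prop := Rᵀ * R = 1 ∧ R.det = 1

/-- Euclidean norm on `ℝ³`. -/
def norm3 (v : V3) : ℝ := Real.sqrt (v ⬝ᵥ v)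

def e1 : V3 := ![1, 0, 0]
def e2 : V3 := ![0, 1, 0]
def e3 : V3 := ![0, 0, 1]

/-- The 3×3 matrix with the given columns. -/
def cols3 (a b c : V3) : M3 := Matrix.of fun i j => ![a i, b i, c i] j

/-- The 3×3 matrix with the given rows. -/
def rows3 (a b c : V3) : M3 := Matrix.of ![a, b, c]

/-- 25-dimensional joint point–line–plane state index
(orientation, gyro bias, velocity, accel bias, position, point, δθ_L, δφ_L, plane CP). -/
abbrev S25 : Type :=
  Fin 3 ⊕ Fin 3 ⊕ Fin 3 ⊕ Fin 3 ⊕ Fin 3 ⊕ Fin 3 ⊕ Fin 3 ⊕ Fin 1 ⊕ Fin 3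

/-- The 3×25 block row `[A B C D E F G w Hm]`. -/
def rowPLP (A B C D E F G : M3) (w : V3) (Hm : M3) : Matrix (Fin 3) S25 ℝ :=
  Matrix.of fun i =>
    Sum.elim (fun j => A i j) (Sum.elim (fun j => B i j) (Sum.elim (fun j => C i j)
      (Sum.elim (fun j => D i j) (Sum.elim (fun j => E i j)
        (Sum.elim (fun j => F i j) (Sum.elim (fun j => G i j)
          (Sum.elim (fun _ => w i) (fun j => Hm i j))))))))

/-- The stacked vector `(a; b; c; d; e; f; g'; s; h)` in ℝ²⁵. -/
def colPLP (a b c d e f g' : V3) (s : ℝ) (h : V3) : S25 → ℝ :=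
  Sum.elim a (Sum.elim b (Sum.elim c (Sum.elim d (Sum.elim e
    (Sum.elim f (Sum.elim g' (Sum.elim (fun _ => s) h)))))))

/-- The 25×3 stacked blocks `(A; B; C; D; E; F; G; r; Hm)`. -/
def stackPLP (A B C D E F G : M3) (r : V3) (Hm : M3) : Matrix S25 (Fin 3) ℝ :=
  Matrix.of (Sum.elim (fun i => A i) (Sum.elim (fun i => B i) (Sum.elim (fun i => C i)
    (Sum.elim (fun i => D i) (Sum.elim (fun i => E i)
      (Sum.elim (fun i => F i) (Sum.elim (fun i => G i)
        (Sum.elim (fun _ => r) (fun i => Hm i)))))))))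

lemma rowPLP_mulVec_colPLP (A B C D E F G : M3) (w : V3) (K : M3)
    (a b c d e f g : V3) (s : ℝ) (h : V3) :
    rowPLP A B C D E F G w K *ᵥ colPLP a b c d e f g s h =
      A *ᵥ a + B *ᵥ b + C *ᵥ c + D *ᵥ d + E *ᵥ e + F *ᵥ f + G *ᵥ g + s • w + K *ᵥ h := by
  ext i
  simp [rowPLP, colPLP, mulVec, dotProduct]
  ring

lemma stackPLP_mulVec (A B C D E F G : M3) (r : V3) (K : M3) (x : V3) :
    stackPLP A B C D E F G r K *ᵥ x =
      colPLP (A *ᵥ x) (B *ᵥ x) (C *ᵥ x) (D *ᵥ x) (E *ᵥ x) (F *ᵥ x) (G *ᵥ x) (r ⬝ᵥ x)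
        (K *ᵥ x) := by
  ext i
  rcases i with i | i | i | i | i | i | i | i | i <;> rfl

lemma colPLP_dotProduct_colPLP (a b c d e f g a' b' c' d' e' f' g' : V3) (s s' : ℝ) (h h' : V3) :
    colPLP a b c d e f g s h ⬝ᵥ colPLP a' b' c' d' e' f' g' s' h' =
      a ⬝ᵥ a' + b ⬝ᵥ b' + c ⬝ᵥ c' + d ⬝ᵥ d' + e ⬝ᵥ e' + f ⬝ᵥ f' + g ⬝ᵥ g' + s * s' + h ⬝ᵥ h' := by
  simp [colPLP, dotProduct]
  ring

lemma mul_of_cols_eq_zero {m : Type*} {k : Type*} [Fintype k] (M : Matrix m k ℝ) (u v w : k → ℝ)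
    (hu : M *ᵥ u = 0) (hv : M *ᵥ v = 0) (hw : M *ᵥ w = 0) :
    M * Matrix.of (fun s j => ![u s, v s, w s] j) = (0 : Matrix m (Fin 3) ℝ) := by
  ext i j
  fin_cases j
  · exact congrFun hu i
  · exact congrFun hv i
  · exact congrFun hw i

lemma vecMul_of_cols_eq_zero {k : Type*} [Fintype k] (z u v w : k → ℝ)
    (hu : z ⬝ᵥ u = 0) (hv : z ⬝ᵥ v = 0) (hw : z ⬝ᵥ w = 0) :
    z ᵥ* Matrix.of (fun s j => ![u s, v s, w s] j) = (0 : Fin 3 → ℝ) := by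
  ext j
  fin_cases j
  · exact hu
  · exact hv
  · exact hw

lemma skew_mulVec (v w : V3) : skew v *ᵥ w =
    ![v 1 * w 2 - v 2 * w 1, v 2 * w 0 - v 0 * w 2, v 0 * w 1 - v 1 * w 0] := by
  ext i
  fin_cases i <;> simp [skew, mulVec, dotProduct, Fin.sum_univ_three] <;> ring

lemma IsRot.mulVec_transpose_mulVec {R : M3} (hR : IsRot R) (x : V3) : R *ᵥ Rᵀ *ᵥ x = x := by
  rw [mulVec_mulVec, mul_eq_one_comm.mp hR.1, one_mulVec]

lemma norm3_sq (v : V3) : norm3 v ^ 2 = v ⬝ᵥ v :=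
  Real.sq_sqrt (by simpa using dotProduct_star_self_nonneg v)

lemma norm3_ne_zero {v : V3} (hv : v ≠ 0) : norm3 v ≠ 0 := fun h => hv <| by
  have := norm3_sq v
  rw [h] at this
  exact dotProduct_self_eq_zero.mp (by simpa using this.symm)

/-- `⌊a×⌋⌊a×⌋b = -‖a‖²b` for `a ⟂ b`, applied to `x` through the triple product expansion. -/
lemma skew_mulVec_of_orthogonal (a b x : V3) (hab : a ⬝ᵥ b = 0) :
    (a ⬝ᵥ a) • (skew b *ᵥ x) + (a ⬝ᵥ x) • (skew a *ᵥ b) - ((skew a *ᵥ b) ⬝ᵥ x) • a = 0 := by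
  simp only [dotProduct, Fin.sum_univ_three] at hab
  ext i
  fin_cases i <;> simp [skew_mulVec, dotProduct, Fin.sum_univ_three]
  · linear_combination (a 1 * x 2 - a 2 * x 1) * hab
  · linear_combination (a 2 * x 0 - a 0 * x 2) * hab
  · linear_combination (a 0 * x 1 - a 1 * x 0) * hab

lemma point_rotation_null (R : M3) (hR : IsRot R) (g P Q V : V3) (t : ℝ) :
    (skew (Q - P - t • V + (t ^ 2 / 2) • g) * R) *ᵥ Rᵀ *ᵥ g
      + ((-t) • (1 : M3)) *ᵥ -(skew V *ᵥ g) + (-1 : M3) *ᵥ -(skew P *ᵥ g)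
      + (1 : M3) *ᵥ -(skew Q *ᵥ g) = 0 := by
  rw [← mulVec_mulVec, hR.mulVec_transpose_mulVec]
  ext i
  fin_cases i <;> simp [skew_mulVec, smul_mulVec, neg_mulVec] <;> ring

lemma line_rotation_null (R : M3) (hR : IsRot R) (g nL vL P V Pk : V3) (t : ℝ) :
    ((skew nL - skew (skew Pk *ᵥ vL) + skew vL * skew P + t • (skew vL * skew V)
        - (t ^ 2 / 2) • (skew vL * skew g) - skew vL * skew Pk) * R) *ᵥ Rᵀ *ᵥ g
      + (t • skew vL) *ᵥ -(skew V *ᵥ g) + skew vL *ᵥ -(skew P *ᵥ g)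
      + (skew nL - skew Pk * skew vL) *ᵥ -g = 0 := by
  rw [← mulVec_mulVec, hR.mulVec_transpose_mulVec]
  simp only [sub_mulVec, add_mulVec, smul_mulVec, ← mulVec_mulVec]
  ext i
  fin_cases i <;> simp [skew_mulVec] <;> ring

lemma plane_rotation_null (R : M3) (hR : IsRot R) (g n P V Pk : V3) (d t : ℝ) (hd : d ≠ 0) :
    (((d - n ⬝ᵥ Pk) • skew n
        - vecMulVec n n * skew (P + t • V - (t ^ 2 / 2) • g - Pk)) * R) *ᵥ Rᵀ *ᵥ g
      + ((-t) • vecMulVec n n) *ᵥ -(skew V *ᵥ g) + (-(vecMulVec n n)) *ᵥ -(skew P *ᵥ g)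
      + (d⁻¹ • ((d - n ⬝ᵥ Pk) • (1 : M3) - vecMulVec n Pk
        + (2 * (n ⬝ᵥ Pk)) • vecMulVec n n)) *ᵥ -(skew (d • n) *ᵥ g) = 0 := by
  have hcp : -(skew (d • n) *ᵥ g) = d • -(skew n *ᵥ g) := by
    ext i
    fin_cases i <;> simp [skew_mulVec] <;> ring
  rw [← mulVec_mulVec, hR.mulVec_transpose_mulVec, hcp, mulVec_smul, smul_mulVec (b := d⁻¹),
    smul_smul, mul_inv_cancel₀ hd, one_smul]
  simp only [sub_mulVec, add_mulVec, smul_mulVec, neg_mulVec, ← mulVec_mulVec, one_mulVec,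
    vecMulVec_mulVec, op_smul_eq_smul]
  ext i
  simp only [Pi.add_apply, Pi.sub_apply, Pi.neg_apply, Pi.smul_apply, Pi.zero_apply]
  fin_cases i <;> simp [skew_mulVec, dotProduct, Fin.sum_univ_three] <;> ring

lemma plane_translation_null (n np1 np2 Pk x : V3) (d : ℝ) (hn : n ⬝ᵥ n = 1) (hd : d ≠ 0) :
    (-(vecMulVec n n)) *ᵥ x
      + (d⁻¹ • ((d - n ⬝ᵥ Pk) • (1 : M3) - vecMulVec n Pk
        + (2 * (n ⬝ᵥ Pk)) • vecMulVec n n)) *ᵥ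
          ((vecMulVec n e3 * (cols3 np1 np2 n)ᵀ) *ᵥ x) = 0 := by
  have h3 : e3 ᵥ* (cols3 np1 np2 n)ᵀ = n := by
    ext i
    simp [e3, cols3, vecMul, dotProduct, Fin.sum_univ_three]
  rw [vecMulVec_mul, h3]
  simp only [sub_mulVec, add_mulVec, smul_mulVec, neg_mulVec, one_mulVec, vecMulVec_mulVec,
    mulVec_smul]
  ext i
  simp [hn, dotProduct_comm Pk n]
  field_simp
  ring

lemma line_translation_null (nL vL Pk x : V3) (hnL : nL ≠ 0) (hvL : vL ≠ 0)
    (horth : nL ⬝ᵥ vL = 0) (H : Matrix (Fin 2) (Fin 3) ℝ)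
    (hH : H *ᵥ (nL - skew Pk *ᵥ vL) = 0) :
    let w₁ : ℝ := norm3 nL
    let w₂ : ℝ := norm3 vL
    let RL : M3 := cols3 (w₁⁻¹ • nL) (w₂⁻¹ • vL) (skew (w₁⁻¹ • nL) *ᵥ (w₂⁻¹ • vL))
    H *ᵥ (skew vL *ᵥ x
      + (skew nL - skew Pk * skew vL) *ᵥ
          ((((w₂ / w₁) • vecMulVec (w₂⁻¹ • vL) e1) * RLᵀ) *ᵥ x)
      + ((((w₁ ^ 2 + w₂ ^ 2)⁻¹ * w₂ ^ 2) • (e3 ᵥ* RLᵀ)) ⬝ᵥ x) •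
          -((w₂ / w₁) • nL + (w₁ / w₂) • (skew Pk *ᵥ vL))) = 0 := by
  intro w₁ w₂ RL
  have hw₁ : w₁ ≠ 0 := norm3_ne_zero hnL
  have hw₂ : w₂ ≠ 0 := norm3_ne_zero hvL
  have hw : w₁ ^ 2 + w₂ ^ 2 ≠ 0 := by positivity
  have hsq : nL ⬝ᵥ nL = w₁ ^ 2 := (norm3_sq nL).symm
  have h1 : e1 ᵥ* RLᵀ = w₁⁻¹ • nL := by
    ext i
    simp [e1, RL, cols3, vecMul, dotProduct, Fin.sum_univ_three]
  have h3 : e3 ᵥ* RLᵀ = (w₁⁻¹ * w₂⁻¹) • (skew nL *ᵥ vL) := by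
    ext i
    simp only [e3, RL, cols3, vecMul, dotProduct, Fin.sum_univ_three]
    fin_cases i <;> simp [skew_mulVec] <;> ring
  have hvv : skew vL *ᵥ vL = 0 := by
    ext i
    fin_cases i <;> simp [skew_mulVec] <;> ring
  have key := skew_mulVec_of_orthogonal nL vL x horth
  rw [hsq] at key
  rw [smul_mul, vecMulVec_mul, h1, h3]
  simp only [sub_mulVec, smul_mulVec, vecMulVec_mulVec, mulVec_smul, ← mulVec_mulVec, hvv,
    mulVec_zero, sub_zero, smul_dotProduct]
  set p := skew Pk *ᵥ vL
  set q := skew nL *ᵥ vL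
  set r := skew vL *ᵥ x
  have hcomb : H *ᵥ (((w₁ ^ 2 + w₂ ^ 2)⁻¹ * (q ⬝ᵥ x)) • (nL - p)) = 0 := by
    rw [mulVec_smul, hH, smul_zero]
  rw [← hcomb]
  congr 1
  ext i
  have ki := congrFun key i
  simp at ki ⊢
  field_simp
  linear_combination (w₁ ^ 2 + w₂ ^ 2) * ki

/-- with a global-z position measurement (and vertical gravity), the
rotation about gravity and the horizontal translations remain unobservable. -/
theorem global_z_measurement_remaining_unobservable
    (nL vL n np1 np2 g Pf P₁ V₁ Pk : V3) (d δt : ℝ) (R₁ : M3) (hR₁ : IsRot R₁)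
    (hnL : nL ≠ 0) (hvL : vL ≠ 0) (horth : nL ⬝ᵥ vL = 0)
    (hn : norm3 n = 1) (hd : d ≠ 0)
    (h11 : np1 ⬝ᵥ np1 = 1) (h22 : np2 ⬝ᵥ np2 = 1) (h12 : np1 ⬝ᵥ np2 = 0)
    (h1n : np1 ⬝ᵥ n = 0) (h2n : np2 ⬝ᵥ n = 0)
    (Γ₂ Γ₄ Γl2 Γl3 A B : M3) (H : Matrix (Fin 2) (Fin 3) ℝ)
    (hH : H *ᵥ (nL - skew Pk *ᵥ vL) = 0)
    (g₀ : ℝ) (hg : g = (-g₀) • e3) :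
    let w₁ : ℝ := norm3 nL
    let w₂ : ℝ := norm3 vL
    let nE : V3 := w₁⁻¹ • nL
    let vE : V3 := w₂⁻¹ • vL
    let ηsq : ℝ := (w₁ ^ 2 + w₂ ^ 2)⁻¹
    let RL : M3 := cols3 nE vE (skew nE *ᵥ vE)
    let RPi : M3 := cols3 np1 np2 n
    let cp : V3 := d • n
    let Γ₁ : M3 := skew (Pf - P₁ - δt • V₁ + (δt ^ 2 / 2) • g) * R₁
    let Γl1 : M3 := (skew nL - skew (skew Pk *ᵥ vL) + skew vL * skew P₁
        + δt • (skew vL * skew V₁) - (δt ^ 2 / 2) • (skew vL * skew g)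
        - skew vL * skew Pk) * R₁
    let Γl4 : M3 := skew nL - skew Pk * skew vL
    let Γl5 : V3 := -((w₂ / w₁) • nL + (w₁ / w₂) • (skew Pk *ᵥ vL))
    let Γπ1 : M3 := ((d - n ⬝ᵥ Pk) • skew n
        - vecMulVec n n * skew (P₁ + δt • V₁ - (δt ^ 2 / 2) • g - Pk)) * R₁
    let Γπ4 : M3 := d⁻¹ • ((d - n ⬝ᵥ Pk) • (1 : M3) - vecMulVec n Pk
        + (2 * (n ⬝ᵥ Pk)) • vecMulVec n n)
    let Mp : Matrix (Fin 3) S25 ℝ :=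
      rowPLP Γ₁ Γ₂ ((-δt) • (1 : M3)) Γ₄ (-1) 1 0 0 0
    let Ml : Matrix (Fin 2) S25 ℝ :=
      H * rowPLP Γl1 Γl2 (δt • skew vL) Γl3 (skew vL) 0 Γl4 Γl5 0
    let Mπ : Matrix (Fin 3) S25 ℝ :=
      rowPLP Γπ1 A ((-δt) • vecMulVec n n) B (-(vecMulVec n n)) 0 0 0 Γπ4
    let c1 : S25 → ℝ :=
      colPLP (R₁ᵀ *ᵥ g) 0 (-(skew V₁ *ᵥ g)) 0 (-(skew P₁ *ᵥ g))
        (-(skew Pf *ᵥ g)) (-g) 0 (-(skew cp *ᵥ g))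
    let Cm : Matrix S25 (Fin 3) ℝ :=
      stackPLP 0 0 0 0 1 1 (((w₂ / w₁) • vecMulVec vE e1) * RLᵀ)
        ((ηsq * w₂ ^ 2) • (e3 ᵥ* RLᵀ)) (vecMulVec n e3 * RPiᵀ)
    let hz : S25 → ℝ := colPLP 0 0 0 0 e3 0 0 0 0
    let Nz : Matrix S25 (Fin 3) ℝ :=
      Matrix.of fun s j => ![c1 s, (Cm *ᵥ e1) s, (Cm *ᵥ e2) s] j
    hz ᵥ* Nz = 0 ∧ Mp * Nz = 0 ∧ Ml * Nz = 0 ∧ Mπ * Nz = 0 ∧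
      e3 ⬝ᵥ (skew P₁ *ᵥ g) = 0 := by
  intro w₁ w₂ nE vE ηsq RL RPi cp Γ₁ Γl1 Γl4 Γl5 Γπ1 Γπ4 Mp Ml Mπ c1 Cm hz Nz
  have hnn : n ⬝ᵥ n = 1 := by rw [← norm3_sq, hn, one_pow]
  have hz0 : e3 ⬝ᵥ (skew P₁ *ᵥ g) = 0 := by
    simp [hg, skew_mulVec, e3]
  have hMp (x : V3) : Mp *ᵥ (Cm *ᵥ x) = 0 := by
    simp only [Mp, Cm, stackPLP_mulVec, rowPLP_mulVec_colPLP]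
    simp [neg_mulVec]
  have hMl (x : V3) : Ml *ᵥ (Cm *ᵥ x) = 0 := by
    simp only [Ml, Cm, stackPLP_mulVec, ← mulVec_mulVec _ H, rowPLP_mulVec_colPLP, zero_mulVec, mulVec_zero,
      one_mulVec, add_zero, zero_add]
    exact line_translation_null nL vL Pk x hnL hvL horth H hH
  have hMπ (x : V3) : Mπ *ᵥ (Cm *ᵥ x) = 0 := by
    simp only [Mπ, Cm, stackPLP_mulVec, rowPLP_mulVec_colPLP, zero_mulVec, mulVec_zero, smul_zero,
      one_mulVec, add_zero, zero_add]
    exact plane_translation_null n np1 np2 Pk x d hnn hd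
  refine ⟨vecMul_of_cols_eq_zero _ _ _ _ ?_ ?_ ?_,
    mul_of_cols_eq_zero _ _ _ _ ?_ (hMp e1) (hMp e2),
    mul_of_cols_eq_zero _ _ _ _ ?_ (hMl e1) (hMl e2),
    mul_of_cols_eq_zero _ _ _ _ ?_ (hMπ e1) (hMπ e2), hz0⟩
  · simp only [hz, c1, colPLP_dotProduct_colPLP]
    simp [hz0]
  · simp only [hz, Cm, stackPLP_mulVec, colPLP_dotProduct_colPLP]
    simp [e1, e3]
  · simp only [hz, Cm, stackPLP_mulVec, colPLP_dotProduct_colPLP]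
    simp [e2, e3]
  · simp only [Mp, c1, rowPLP_mulVec_colPLP, mulVec_zero, zero_mulVec, add_zero, zero_smul]
    exact point_rotation_null R₁ hR₁ g P₁ Pf V₁ δt
  · simp only [Ml, c1, ← mulVec_mulVec, rowPLP_mulVec_colPLP, mulVec_zero, zero_mulVec, add_zero,
      zero_smul]
    rw [line_rotation_null R₁ hR₁ g nL vL P₁ V₁ Pk δt, mulVec_zero]
  · simp only [Mπ, c1, rowPLP_mulVec_colPLP, mulVec_zero, zero_mulVec, add_zero, zero_smul]
    exact plane_rotation_null R₁ hR₁ g n P₁ V₁ Pk d δt hd
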